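/- Let f be a profile function whose derivative f' extends continuously to [-1,1], such that x ↦ f(x)^m · f''(x) is interval integrable on [-1,1] for every m ≥ 1, and let Λ : ℕ → ℝ be the strictly increasing enumeration of E(f) = ⋃_{k ≥ 0} Spec L_k. Set K(x) = -f''(x)/2. If for every integer m ≥ 1 equality holds, i.e., Λ(m) = m² · (∫_{-1}^{1} f^{m-1})/(∫_{-1}^{1} f^{m}) + (m · ∫_{-1}^{1} f^{m} K)/(2∫_{-1}^{1} f^{m}), then f(x) = 1 - x² for all x ∈ [-1,1]. -/

import Mathlib

open Set MeasureTheory intervalIntegral Filter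

/-- A profile function for a surface of revolution diffeomorphic to `S²` of area `4π`:
continuous on `[-1,1]`, smooth and positive on `(-1,1)`, vanishing at `±1`,
with derivative `2` at `-1` and `-2` at `1`. -/
structure IsProfile (f : ℝ → ℝ) : Prop where
  contOn : ContinuousOn f (Icc (-1) 1)
  smoothOn : ContDiffOn ℝ (⊤ : ℕ∞) f (Ioo (-1) 1)
  pos : ∀ x ∈ Ioo (-1:ℝ) 1, 0 < f x
  zero_neg_one : f (-1) = 0
  zero_one : f 1 = 0
  deriv_neg_one : HasDerivAt f 2 (-1)
  deriv_one : HasDerivAt f (-2) 1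

/-- `λ` is an eigenvalue of the Sturm–Liouville operator
`L_k = -(d/dx)(f(x) d/dx) + k²/f(x)` on `(-1,1)`, with Dirichlet boundary
conditions at `±1` when `k ≥ 1`. -/
def InSpec (f : ℝ → ℝ) (k : ℕ) (lam : ℝ) : Prop :=
  ∃ u : ℝ → ℝ, ContinuousOn u (Icc (-1) 1) ∧ ContDiffOn ℝ (⊤ : ℕ∞) u (Ioo (-1) 1) ∧
    (∃ x ∈ Ioo (-1:ℝ) 1, u x ≠ 0) ∧
    (1 ≤ k → u (-1) = 0 ∧ u 1 = 0) ∧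
    ∀ x ∈ Ioo (-1:ℝ) 1,
      -(deriv (fun y => f y * deriv u y) x) + ((k:ℝ)^2 / f x) * u x = lam * u x

/-- The spectrum of `L_k`. -/
def Spec (f : ℝ → ℝ) (k : ℕ) : Set ℝ := {lam | InSpec f k lam}

/-- The set of distinct eigenvalues of the Laplacian of the surface of
revolution determined by `f`. -/
def Eigs (f : ℝ → ℝ) : Set ℝ := ⋃ k : ℕ, Spec f k

open scoped Topology BoundedContinuousFunction

namespace KernelOperator

variable {X : Type*} [TopologicalSpace X] [CompactSpace X]

/-- The evaluation operator `u ↦ (x ↦ ⟪Γ x, u⟫)` of a continuous family of vectors. -/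
noncomputable def evalOp {H : Type*} [NormedAddCommGroup H] [InnerProductSpace ℝ H]
    (Γ : C(X, H)) : H →L[ℝ] (X →ᵇ ℝ) :=
  LinearMap.mkContinuous
    { toFun := fun u => BoundedContinuousFunction.mkOfCompact
        ⟨fun x => inner ℝ (Γ x) u, Γ.continuous.inner continuous_const⟩
      map_add' := fun u v => by ext x; simp [inner_add_right]
      map_smul' := fun c u => by ext x; simp [inner_smul_right] }
    ‖Γ‖ (fun u => by
      refine (BoundedContinuousFunction.norm_le (by positivity)).2 fun x => ?_
      exact (norm_inner_le_norm _ _).trans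
        (mul_le_mul_of_nonneg_right (Γ.norm_coe_le_norm x) (norm_nonneg _)))

@[simp]
theorem evalOp_apply {H : Type*} [NormedAddCommGroup H] [InnerProductSpace ℝ H]
    (Γ : C(X, H)) (u : H) (x : X) : evalOp Γ u x = inner ℝ (Γ x) u := rfl

theorem isCompactOperator_evalOp {H : Type*} [NormedAddCommGroup H] [InnerProductSpace ℝ H]
    (Γ : C(X, H)) : IsCompactOperator (evalOp Γ) := by
  refine (isCompactOperator_iff_isCompact_closure_image_closedBall
    ((evalOp Γ : H →L[ℝ] (X →ᵇ ℝ)) : H →ₗ[ℝ] (X →ᵇ ℝ)) one_pos).2 ?_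
  refine BoundedContinuousFunction.arzela_ascoli (Metric.closedBall 0 ‖Γ‖)
    (isCompact_closedBall _ _) _ ?_ ?_
  · rintro _ x ⟨u, hu, rfl⟩
    rw [mem_closedBall_zero_iff] at hu ⊢
    refine (norm_inner_le_norm (Γ x) u).trans ?_
    calc ‖Γ x‖ * ‖u‖ ≤ ‖Γ‖ * 1 := by
          gcongr
          exact Γ.norm_coe_le_norm x
      _ = ‖Γ‖ := mul_one _
  · intro x₀
    refine Metric.equicontinuousAt_of_continuity_modulus (fun x => ‖Γ x₀ - Γ x‖) ?_ _ ?_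
    · have : Continuous fun x => ‖Γ x₀ - Γ x‖ := by fun_prop
      simpa using this.tendsto x₀
    · refine Eventually.of_forall ?_
      rintro x ⟨_, u, hu, rfl⟩
      rw [mem_closedBall_zero_iff] at hu
      change dist (inner ℝ (Γ x₀) u) (inner ℝ (Γ x) u) ≤ _
      rw [dist_eq_norm, ← inner_sub_left]
      refine (norm_inner_le_norm _ _).trans ?_
      exact mul_le_of_le_one_right (norm_nonneg _) hu

/-- A compact self-adjoint operator attains its norm, up to sign, as an eigenvalue. -/
theorem exists_eigenvector_norm {H : Type*} [NormedAddCommGroup H] [InnerProductSpace ℝ H]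
    [CompleteSpace H] (T : H →L[ℝ] H) (hT : IsCompactOperator T) (hs : T.IsSymmetric)
    (h0 : T ≠ 0) : ∃ c : ℝ, ∃ v : H, |c| = ‖T‖ ∧ v ≠ 0 ∧ T v = c • v := by
  have : Nontrivial H := by
    by_contra h
    rw [not_nontrivial_iff_subsingleton] at h
    exact h0 (by ext x; exact Subsingleton.elim _ _)
  have hn : ‖T‖ ≠ 0 := norm_ne_zero_iff.2 h0
  have h : ‖T‖ ∈ spectrum ℝ T ∨ -‖T‖ ∈ spectrum ℝ T := by
    simp_rw [spectrum, Set.mem_compl_iff]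
    by_contra! h
    obtain ⟨c, hc0, hc⟩ := T.abs_rayleighQuotient_le_of_norm_mem_resolventSet h.1 h.2
    have := ciSup_le hc
    rw [← T.norm_eq_iSup_rayleighQuotient hs] at this
    linarith
  have key : ∀ c : ℝ, |c| = ‖T‖ → c ∈ spectrum ℝ T →
      ∃ c : ℝ, ∃ v : H, |c| = ‖T‖ ∧ v ≠ 0 ∧ T v = c • v := by
    intro c hc hcs
    have hc0 : c ≠ 0 := fun h => hn (by rw [← hc, h, abs_zero])
    obtain ⟨v, hv⟩ := ((hT.hasEigenvalue_iff_mem_spectrum hc0).2 hcs).exists_hasEigenvector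
    exact ⟨c, v, hc, hv.2, hv.apply_eq_smul⟩
  rcases h with h | h
  · exact key _ (by simp) h
  · exact key _ (by simp) h

/-- Perron–Frobenius for bounded symmetric positive kernels. -/
theorem exists_nonneg_eigenfunction [MeasurableSpace X] [BorelSpace X]
    [SecondCountableTopology X]
    (μ : Measure X) [IsFiniteMeasure μ] (hμ : μ ≠ 0) (G : X → X → ℝ)
    (hm : Measurable (Function.uncurry G)) (C : ℝ)
    (hC : ∀ x y, G x y ≤ C) (hpos : ∀ x y, 0 ≤ G x y) (hpos' : ∀ᵐ x ∂μ, ∀ᵐ y ∂μ, 0 < G x y)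
    (hsymm : ∀ x y, G x y = G y x)
    (hcont : ∀ y, Continuous fun x => G x y) :
    ∃ M : ℝ, 0 < M ∧ ∃ w : X → ℝ, Continuous w ∧
      (∀ x, (∀ᵐ y ∂μ, 0 < G x y) → 0 < w x) ∧
      ∀ x, M * w x = ∫ y, G x y * w y ∂μ := by
  have hmx : ∀ x, AEStronglyMeasurable (G x) μ := fun x =>
    (hm.comp measurable_prodMk_left).aestronglyMeasurable
  have hb : ∀ x y, ‖G x y‖ ≤ C := fun x y => by
    rw [Real.norm_of_nonneg (hpos x y)]; exact hC x y
  have hmem : ∀ x, MemLp (G x) 2 μ := fun x =>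
    MemLp.of_bound (hmx x) C (Eventually.of_forall (hb x))
  have hnorm : ∀ x x', ‖(hmem x).toLp - (hmem x').toLp‖ ^ 2 = ∫ y, (G x y - G x' y) ^ 2 ∂μ := by
    intro x x'
    rw [← real_inner_self_eq_norm_sq, ← MemLp.toLp_sub, L2.inner_def]
    refine integral_congr_ae ?_
    filter_upwards [((hmem x).sub (hmem x')).coeFn_toLp] with y hy
    simp [hy, sq]
  have hΓ : Continuous fun x => (hmem x).toLp := by
    rw [continuous_iff_continuousAt]
    intro x'
    rw [ContinuousAt, tendsto_iff_norm_sub_tendsto_zero]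
    have h1 : Tendsto (fun x => ∫ y, (G x y - G x' y) ^ 2 ∂μ) (𝓝 x')
        (𝓝 (∫ y, (G x' y - G x' y) ^ 2 ∂μ)) := by
      refine tendsto_integral_filter_of_dominated_convergence (fun _ => (2 * C) ^ 2) ?_ ?_
        (integrable_const _) ?_
      · exact Eventually.of_forall fun x => ((hmx x).sub (hmx x')).pow 2
      · refine Eventually.of_forall fun x => Eventually.of_forall fun y => ?_
        rw [norm_pow]
        refine pow_le_pow_left₀ (norm_nonneg _) ?_ 2
        refine (norm_sub_le _ _).trans ?_
        linarith [hb x y, hb x' y]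
      · refine Eventually.of_forall fun y => ?_
        exact (((hcont y).tendsto x').sub_const _).pow 2
    have h2 := h1.sqrt
    simp only [sub_self, ne_eq, OfNat.ofNat_ne_zero, not_false_eq_true, zero_pow,
      integral_zero, Real.sqrt_zero] at h2
    refine h2.congr fun x => ?_
    rw [← hnorm, Real.sqrt_sq (norm_nonneg _)]
  let Γ : C(X, Lp ℝ 2 μ) := ⟨_, hΓ⟩
  have hS : ∀ (u : Lp ℝ 2 μ) x, evalOp Γ u x = ∫ y, G x y * u y ∂μ := by
    intro u x
    rw [evalOp_apply, L2.inner_def]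
    refine integral_congr_ae ?_
    filter_upwards [(hmem x).coeFn_toLp] with y hy
    change inner ℝ (((hmem x).toLp : Lp ℝ 2 μ) y) (u y) = _
    simp [hy, mul_comm]
  let T : Lp ℝ 2 μ →L[ℝ] Lp ℝ 2 μ := (BoundedContinuousFunction.toLp 2 μ ℝ).comp (evalOp Γ)
  have hTc : IsCompactOperator T :=
    (isCompactOperator_evalOp Γ).clm_comp (BoundedContinuousFunction.toLp 2 μ ℝ)
  have hT : ∀ u, T u =ᵐ[μ] evalOp Γ u := fun u => BoundedContinuousFunction.coeFn_toLp _ _ _ _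
  have hTi : ∀ u v, inner ℝ (T u) v = ∫ x, (∫ y, G x y * u y ∂μ) * v x ∂μ := by
    intro u v
    rw [L2.inner_def]
    refine integral_congr_ae ?_
    filter_upwards [hT u] with x hx
    simp [hx, hS, -evalOp_apply, mul_comm]
  have hi : ∀ u : Lp ℝ 2 μ, Integrable u μ := fun u => (Lp.memLp u).integrable (by norm_num)
  have hprod : ∀ u v : Lp ℝ 2 μ,
      Integrable (fun z : X × X => G z.1 z.2 * (u z.2 * v z.1)) (μ.prod μ) := by
    intro u v
    refine Integrable.bdd_mul (c := C) ?_ hm.aestronglyMeasurable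
      (Eventually.of_forall fun z => hb z.1 z.2)
    simpa [mul_comm] using (hi v).mul_prod (hi u)
  have hsymT : T.IsSymmetric := by
    intro u v
    change inner ℝ (T u) v = inner ℝ u (T v)
    rw [real_inner_comm (T v) u, hTi, hTi]
    simp_rw [← MeasureTheory.integral_mul_const]
    rw [integral_integral_swap]
    · refine integral_congr_ae (Eventually.of_forall fun y => ?_)
      refine integral_congr_ae (Eventually.of_forall fun x => ?_)
      simp only [hsymm y x]; ring
    · simpa [Function.uncurry_def, mul_assoc] using hprod u v
  have habs : ∀ v : Lp ℝ 2 μ, |inner ℝ (T v) v| ≤ inner ℝ (T |v|) |v| := by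
    intro v
    have hiv : ∀ v : Lp ℝ 2 μ, Integrable (fun x => (∫ y, G x y * v y ∂μ) * v x) μ := by
      intro v
      have := (hprod v v).integral_prod_left
      refine this.congr (Eventually.of_forall fun x => ?_)
      simp only [← mul_assoc]
      rw [MeasureTheory.integral_mul_const]
    rw [hTi, hTi]
    refine MeasureTheory.abs_integral_le_integral_abs.trans ?_
    refine integral_mono_ae (hiv v).abs (hiv _) ?_
    filter_upwards [Lp.coeFn_abs v] with x hx
    simp only [hx, abs_mul]
    refine mul_le_mul_of_nonneg_right ?_ (abs_nonneg _)
    refine MeasureTheory.abs_integral_le_integral_abs.trans (le_of_eq (integral_congr_ae ?_))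
    filter_upwards [Lp.coeFn_abs v] with y hy
    simp only [hy, abs_mul, abs_of_nonneg (hpos x y)]
  have hker : ∀ v : Lp ℝ 2 μ, 0 ≤ v → ∀ x, (∀ᵐ y ∂μ, 0 < G x y) → evalOp Γ v x = 0 → v = 0 := by
    intro v hv x hx h'
    have hv' := (Lp.coeFn_nonneg v).2 hv
    rw [hS, MeasureTheory.integral_eq_zero_iff_of_nonneg_ae] at h'
    · rw [Lp.eq_zero_iff_ae_eq_zero]
      filter_upwards [h', hx] with y hy hy'
      exact (mul_eq_zero.1 hy).resolve_left hy'.ne'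
    · filter_upwards [hv'] with y hy
      exact mul_nonneg (hpos x y) hy
    · exact (hi v).bdd_mul (hmx x) (Eventually.of_forall (hb x))
  have hT0 : T ≠ 0 := by
    intro h0
    let v : Lp ℝ 2 μ := (memLp_const (1:ℝ)).toLp
    have hv1 : v =ᵐ[μ] fun _ => 1 := (memLp_const (1:ℝ)).coeFn_toLp
    have hz : T v = 0 := by rw [h0]; rfl
    have hz' := (hT v).symm.trans ((Lp.eq_zero_iff_ae_eq_zero).1 hz)
    have := NeZero.mk hμ
    obtain ⟨x, hx, hx'⟩ := (hz'.and hpos').exists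
    rw [hS, MeasureTheory.integral_congr_ae (g := G x) (by
      filter_upwards [hv1] with y hy
      rw [hy, mul_one])] at hx
    have h3 := (MeasureTheory.integral_eq_zero_iff_of_nonneg (hpos x)
      ((hmem x).integrable (by norm_num))).1 hx
    obtain ⟨y, hy, hy'⟩ := (h3.and hx').exists
    exact hy'.ne' hy
  obtain ⟨c, v, hc, hv0, hv⟩ := exists_eigenvector_norm T hTc hsymT hT0
  have hM : 0 < ‖T‖ := norm_pos_iff.2 hT0
  have hw : T |v| = ‖T‖ • |v| := by
    have h1 := habs v
    rw [hv, real_inner_smul_left, real_inner_self_eq_norm_sq, abs_mul, hc,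
      abs_of_nonneg (sq_nonneg _)] at h1
    have h2 : ‖T |v|‖ ≤ ‖T‖ * ‖v‖ :=
      (T.le_opNorm |v|).trans_eq (by rw [norm_abs_eq_norm])
    have h3 : ‖T |v| - ‖T‖ • |v|‖ ^ 2 ≤ 0 := by
      rw [norm_sub_sq_real, real_inner_smul_right, norm_smul, norm_norm, norm_abs_eq_norm]
      have := pow_le_pow_left₀ (norm_nonneg _) h2 2
      nlinarith
    have h4 : ‖T |v| - ‖T‖ • |v|‖ = 0 := by
      have := norm_nonneg (T |v| - ‖T‖ • |v|)
      nlinarith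
    exact sub_eq_zero.1 (norm_eq_zero.1 h4)
  have hwae : ∀ᵐ x ∂μ, evalOp Γ |v| x = ‖T‖ * (|v| : Lp ℝ 2 μ) x := by
    have h1 := hT |v|
    rw [hw] at h1
    filter_upwards [h1, Lp.coeFn_smul ‖T‖ |v|] with x hx hx'
    rw [← hx, hx']; rfl
  have hvnn := (Lp.coeFn_nonneg |v|).2 (abs_nonneg v)
  refine ⟨‖T‖, hM, evalOp Γ |v|, (evalOp Γ |v|).continuous, ?_, ?_⟩
  · intro x hx
    refine lt_of_le_of_ne ?_ fun h => ?_
    · rw [hS]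
      refine integral_nonneg_of_ae ?_
      filter_upwards [hvnn] with y hy
      exact mul_nonneg (hpos x y) hy
    · have h1 := congrArg norm (hker |v| (abs_nonneg _) x hx h.symm)
      rw [norm_abs_eq_norm, norm_zero] at h1
      exact hv0 (norm_eq_zero.1 h1)
  · intro x
    rw [hS, ← MeasureTheory.integral_const_mul]
    refine integral_congr_ae ?_
    filter_upwards [hwae] with y hy
    rw [hy]; ring

end KernelOperator

theorem IsProfile.hasDerivAt {f : ℝ → ℝ} (hf : IsProfile f) {x : ℝ} (hx : x ∈ Icc (-1:ℝ) 1) :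
    HasDerivAt f (deriv f x) x := by
  rw [hasDerivAt_deriv_iff]
  rcases eq_or_ne x (-1) with rfl | h1
  · exact hf.deriv_neg_one.differentiableAt
  rcases eq_or_ne x 1 with rfl | h2
  · exact hf.deriv_one.differentiableAt
  have hx' : x ∈ Ioo (-1:ℝ) 1 := ⟨lt_of_le_of_ne hx.1 h1.symm, lt_of_le_of_ne hx.2 h2⟩
  exact (hf.smoothOn.contDiffAt (isOpen_Ioo.mem_nhds hx')).differentiableAt (by simp)

/-- The isothermal coordinate `t = ∫ dx / f` along the meridians. -/
noncomputable def isothermal (f : ℝ → ℝ) (x : ℝ) : ℝ := ∫ y in (0:ℝ)..x, 1 / f y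

/-- The solution `exp t` of `L_1 u = 0`, extended by zero outside `(-1,1)`. -/
noncomputable def expPos (f : ℝ → ℝ) : ℝ → ℝ :=
  (Ioo (-1:ℝ) 1).indicator fun x => Real.exp (isothermal f x)

/-- The solution `exp (-t)` of `L_1 u = 0`, extended by zero outside `(-1,1)`. -/
noncomputable def expNeg (f : ℝ → ℝ) : ℝ → ℝ :=
  (Ioo (-1:ℝ) 1).indicator fun x => Real.exp (-isothermal f x)

/-- Twice the Green's kernel `exp (-|t x - t y|)` of `L_1`. -/
noncomputable def greenKernel (f : ℝ → ℝ) (x y : ℝ) : ℝ :=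
  min (expPos f x * expNeg f y) (expPos f y * expNeg f x)

namespace IsProfile

variable {f : ℝ → ℝ}

theorem continuousOn_inv (hf : IsProfile f) : ContinuousOn (fun x => 1 / f x) (Ioo (-1) 1) :=
  continuousOn_const.div (hf.contOn.mono Ioo_subset_Icc_self) fun x hx => (hf.pos x hx).ne'

theorem hasDerivAt_isothermal (hf : IsProfile f) {x : ℝ} (hx : x ∈ Ioo (-1:ℝ) 1) :
    HasDerivAt (isothermal f) (1 / f x) x := by
  have h0 : uIcc 0 x ⊆ Ioo (-1:ℝ) 1 := ordConnected_Ioo.uIcc_subset (by norm_num) hx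
  refine integral_hasDerivAt_right (hf.continuousOn_inv.mono h0).intervalIntegrable ?_
    (hf.continuousOn_inv.continuousAt (isOpen_Ioo.mem_nhds hx))
  exact hf.continuousOn_inv.stronglyMeasurableAtFilter isOpen_Ioo x hx

theorem monotoneOn_isothermal (hf : IsProfile f) : MonotoneOn (isothermal f) (Ioo (-1) 1) := by
  refine monotoneOn_of_hasDerivWithinAt_nonneg (f' := fun x => 1 / f x) (convex_Ioo _ _)
    (fun x hx => (hf.hasDerivAt_isothermal hx).continuousAt.continuousWithinAt) ?_ ?_
  · intro x hx
    rw [interior_Ioo] at hx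
    exact (hf.hasDerivAt_isothermal hx).hasDerivWithinAt
  · intro x hx
    rw [interior_Ioo] at hx
    exact (one_div_pos.2 (hf.pos x hx)).le

theorem exists_linear_bound (hf : IsProfile f) (hf' : ContinuousOn (deriv f) (Icc (-1) 1)) :
    ∃ C > 0, ∀ x ∈ Ioo (-1:ℝ) 1, f x ≤ C * (1 - x) ∧ f x ≤ C * (x + 1) := by
  obtain ⟨C, hC⟩ := isCompact_Icc.exists_bound_of_continuousOn hf'
  have hL : ∀ x ∈ Icc (-1:ℝ) 1, ∀ y ∈ Icc (-1:ℝ) 1, ‖f y - f x‖ ≤ C * ‖y - x‖ :=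
    fun x hx y hy => Convex.norm_image_sub_le_of_norm_hasDerivWithin_le
      (fun z hz => (hf.hasDerivAt hz).hasDerivWithinAt) hC (convex_Icc _ _) hx hy
  have hC0 : 2 ≤ C := by
    have := hC (-1) (by norm_num)
    rw [hf.deriv_neg_one.deriv] at this
    simpa using this
  refine ⟨C, by linarith, fun x hx => ⟨?_, ?_⟩⟩
  · have := hL 1 (by norm_num) x (Ioo_subset_Icc_self hx)
    rw [hf.zero_one, sub_zero, Real.norm_eq_abs, Real.norm_eq_abs,
      abs_of_neg (by linarith [hx.2] : x - 1 < 0)] at this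
    linarith [le_abs_self (f x)]
  · have := hL (-1) (by norm_num) x (Ioo_subset_Icc_self hx)
    rw [hf.zero_neg_one, sub_zero, Real.norm_eq_abs, Real.norm_eq_abs,
      abs_of_pos (by linarith [hx.1] : 0 < x - -1)] at this
    linarith [le_abs_self (f x)]

theorem isothermal_bounds (hf : IsProfile f) (hf' : ContinuousOn (deriv f) (Icc (-1) 1)) :
    ∃ C > 0, (∀ x ∈ Ico (0:ℝ) 1, -isothermal f x ≤ C * Real.log (1 - x)) ∧
      ∀ x ∈ Ioc (-1:ℝ) 0, isothermal f x ≤ C * Real.log (x + 1) := by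
  obtain ⟨C, hC, hb⟩ := hf.exists_linear_bound hf'
  have ht0 : isothermal f 0 = 0 := integral_same
  refine ⟨1 / C, by positivity, ?_, ?_⟩
  · have hd : ∀ x ∈ Ioo (-1:ℝ) 1, HasDerivAt (fun x => isothermal f x + 1 / C * Real.log (1 - x))
        (1 / f x + 1 / C * (-1 / (1 - x))) x := fun x hx =>
      (hf.hasDerivAt_isothermal hx).add
        ((((hasDerivAt_id x).const_sub 1).log (by linarith [hx.2] : (1 - x) ≠ 0)).const_mul _)
    have hm : MonotoneOn (fun x => isothermal f x + 1 / C * Real.log (1 - x)) (Ioo (-1) 1) := by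
      refine monotoneOn_of_hasDerivWithinAt_nonneg (convex_Ioo _ _)
        (fun x hx => (hd x hx).continuousAt.continuousWithinAt)
        (fun x hx => (hd x (interior_subset hx)).hasDerivWithinAt) fun x hx => ?_
      have hx' : x ∈ Ioo (-1:ℝ) 1 := interior_subset hx
      have h1 : 0 < 1 - x := by linarith [hx'.2]
      have h2 := one_div_le_one_div_of_le (hf.pos x hx') (hb x hx').1
      have h3 : 1 / C * (-1 / (1 - x)) = -(1 / (C * (1 - x))) := by field_simp
      linarith
    intro x hx
    have := hm (by norm_num : (0:ℝ) ∈ Ioo (-1:ℝ) 1) ⟨by linarith [hx.1], hx.2⟩ hx.1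
    simp only [ht0, sub_zero, Real.log_one, mul_zero, add_zero] at this
    linarith
  · have hd : ∀ x ∈ Ioo (-1:ℝ) 1, HasDerivAt (fun x => isothermal f x - 1 / C * Real.log (x + 1))
        (1 / f x - 1 / C * (1 / (x + 1))) x := fun x hx =>
      (hf.hasDerivAt_isothermal hx).sub
        ((((hasDerivAt_id x).add_const 1).log (by linarith [hx.1] : (x + 1) ≠ 0)).const_mul _)
    have hm : MonotoneOn (fun x => isothermal f x - 1 / C * Real.log (x + 1)) (Ioo (-1) 1) := by
      refine monotoneOn_of_hasDerivWithinAt_nonneg (convex_Ioo _ _)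
        (fun x hx => (hd x hx).continuousAt.continuousWithinAt)
        (fun x hx => (hd x (interior_subset hx)).hasDerivWithinAt) fun x hx => ?_
      have hx' : x ∈ Ioo (-1:ℝ) 1 := interior_subset hx
      have h1 : 0 < x + 1 := by linarith [hx'.1]
      have h2 := one_div_le_one_div_of_le (hf.pos x hx') (hb x hx').2
      have h3 : 1 / C * (1 / (x + 1)) = 1 / (C * (x + 1)) := by field_simp
      linarith
    intro x hx
    have := hm ⟨hx.1, by linarith [hx.2]⟩ (by norm_num : (0:ℝ) ∈ Ioo (-1:ℝ) 1) hx.2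
    simp only [ht0, zero_add, Real.log_one, mul_zero, sub_zero] at this
    linarith

end IsProfile

theorem expPos_of_mem {f : ℝ → ℝ} {x : ℝ} (hx : x ∈ Ioo (-1:ℝ) 1) :
    expPos f x = Real.exp (isothermal f x) := indicator_of_mem hx _

theorem expNeg_of_mem {f : ℝ → ℝ} {x : ℝ} (hx : x ∈ Ioo (-1:ℝ) 1) :
    expNeg f x = Real.exp (-isothermal f x) := indicator_of_mem hx _

theorem expPos_of_notMem {f : ℝ → ℝ} {x : ℝ} (hx : x ∉ Ioo (-1:ℝ) 1) : expPos f x = 0 :=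
  indicator_of_notMem hx _

theorem expNeg_of_notMem {f : ℝ → ℝ} {x : ℝ} (hx : x ∉ Ioo (-1:ℝ) 1) : expNeg f x = 0 :=
  indicator_of_notMem hx _

theorem expPos_nonneg (f : ℝ → ℝ) (x : ℝ) : 0 ≤ expPos f x :=
  indicator_nonneg (fun _ _ => (Real.exp_pos _).le) x

theorem expNeg_nonneg (f : ℝ → ℝ) (x : ℝ) : 0 ≤ expNeg f x :=
  indicator_nonneg (fun _ _ => (Real.exp_pos _).le) x

theorem expPos_mul_expNeg {f : ℝ → ℝ} {x : ℝ} (hx : x ∈ Ioo (-1:ℝ) 1) :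
    expPos f x * expNeg f x = 1 := by
  rw [expPos_of_mem hx, expNeg_of_mem hx, ← Real.exp_add, add_neg_cancel, Real.exp_zero]

theorem greenKernel_symm (f : ℝ → ℝ) (x y : ℝ) : greenKernel f x y = greenKernel f y x :=
  min_comm _ _

theorem greenKernel_nonneg (f : ℝ → ℝ) (x y : ℝ) : 0 ≤ greenKernel f x y :=
  le_min (mul_nonneg (expPos_nonneg f x) (expNeg_nonneg f y))
    (mul_nonneg (expPos_nonneg f y) (expNeg_nonneg f x))

theorem greenKernel_pos {f : ℝ → ℝ} {x y : ℝ} (hx : x ∈ Ioo (-1:ℝ) 1) (hy : y ∈ Ioo (-1:ℝ) 1) :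
    0 < greenKernel f x y := by
  rw [greenKernel, expPos_of_mem hx, expPos_of_mem hy, expNeg_of_mem hx, expNeg_of_mem hy]
  positivity

theorem greenKernel_of_notMem {f : ℝ → ℝ} {x y : ℝ} (hy : y ∉ Ioo (-1:ℝ) 1) :
    greenKernel f x y = 0 := by
  simp [greenKernel, expPos_of_notMem hy, expNeg_of_notMem hy]

theorem greenKernel_le_one (f : ℝ → ℝ) (x y : ℝ) : greenKernel f x y ≤ 1 := by
  by_cases hy : y ∈ Ioo (-1:ℝ) 1
  · by_cases hx : x ∈ Ioo (-1:ℝ) 1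
    · rw [greenKernel, expPos_of_mem hx, expPos_of_mem hy, expNeg_of_mem hx, expNeg_of_mem hy,
        ← Real.exp_add, ← Real.exp_add, min_le_iff, Real.exp_le_one_iff, Real.exp_le_one_iff]
      rcases le_total (isothermal f x) (isothermal f y) with h | h
      · exact Or.inl (by linarith)
      · exact Or.inr (by linarith)
    · rw [greenKernel_symm, greenKernel_of_notMem hx]
      exact zero_le_one
  · rw [greenKernel_of_notMem hy]
    exact zero_le_one

namespace IsProfile

variable {f : ℝ → ℝ}

theorem greenKernel_eq_of_le (hf : IsProfile f) {x y : ℝ} (hx : x ∈ Ioo (-1:ℝ) 1)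
    (hy : y ∈ Ioo (-1:ℝ) 1) (h : y ≤ x) : greenKernel f x y = expPos f y * expNeg f x := by
  refine min_eq_right ?_
  rw [expPos_of_mem hx, expPos_of_mem hy, expNeg_of_mem hx, expNeg_of_mem hy,
    ← Real.exp_add, ← Real.exp_add, Real.exp_le_exp]
  linarith [hf.monotoneOn_isothermal hy hx h]

theorem hasDerivAt_expPos (hf : IsProfile f) {x : ℝ} (hx : x ∈ Ioo (-1:ℝ) 1) :
    HasDerivAt (expPos f) (expPos f x / f x) x := by
  have h := (hf.hasDerivAt_isothermal hx).exp.congr_of_eventuallyEq (f₁ := expPos f) (by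
    filter_upwards [isOpen_Ioo.mem_nhds hx] with y hy
    exact expPos_of_mem hy)
  refine h.congr_deriv ?_
  rw [expPos_of_mem hx]; ring

theorem hasDerivAt_expNeg (hf : IsProfile f) {x : ℝ} (hx : x ∈ Ioo (-1:ℝ) 1) :
    HasDerivAt (expNeg f) (-(expNeg f x / f x)) x := by
  have h := (hf.hasDerivAt_isothermal hx).neg.exp.congr_of_eventuallyEq (f₁ := expNeg f) (by
    filter_upwards [isOpen_Ioo.mem_nhds hx] with y hy
    exact expNeg_of_mem hy)
  refine h.congr_deriv ?_
  rw [expNeg_of_mem hx]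
  simp only [Pi.neg_apply]
  ring

theorem continuousOn_expNeg (hf : IsProfile f) (hf' : ContinuousOn (deriv f) (Icc (-1) 1)) :
    ContinuousOn (expNeg f) (Ioc (-1) 1) := by
  intro x hx
  rcases eq_or_ne x 1 with rfl | h1
  · obtain ⟨C, hC, hb, -⟩ := hf.isothermal_bounds hf'
    have h1 : (1:ℝ) ∉ Ioo (-1:ℝ) 1 := by simp
    rw [ContinuousWithinAt, expNeg_of_notMem h1]
    have hlim : Tendsto (fun x : ℝ => (1 - x) ^ C) (𝓝[Ioc (-1) 1] 1) (𝓝 0) := by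
      have : ContinuousAt (fun x : ℝ => (1 - x) ^ C) 1 :=
        ContinuousAt.rpow_const (by fun_prop) (Or.inr hC.le)
      have h2 := this.tendsto.mono_left (nhdsWithin_le_nhds (s := Ioc (-1:ℝ) 1))
      simpa [Real.zero_rpow hC.ne'] using h2
    refine squeeze_zero' (Eventually.of_forall (expNeg_nonneg f)) ?_ hlim
    filter_upwards [self_mem_nhdsWithin, mem_nhdsWithin_of_mem_nhds (Ioi_mem_nhds zero_lt_one)]
      with y hy hy'
    rcases eq_or_lt_of_le hy.2 with rfl | hlt
    · simp [expNeg_of_notMem h1, Real.zero_rpow hC.ne']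
    · rw [expNeg_of_mem ⟨hy.1, hlt⟩, Real.rpow_def_of_pos (by linarith), Real.exp_le_exp, mul_comm]
      exact hb y ⟨le_of_lt hy', hlt⟩
  · exact (hf.hasDerivAt_expNeg ⟨hx.1, lt_of_le_of_ne hx.2 h1⟩).continuousAt.continuousWithinAt

theorem continuousOn_expPos (hf : IsProfile f) (hf' : ContinuousOn (deriv f) (Icc (-1) 1)) :
    ContinuousOn (expPos f) (Ico (-1) 1) := by
  intro x hx
  rcases eq_or_ne x (-1) with rfl | h1
  · obtain ⟨C, hC, -, hb⟩ := hf.isothermal_bounds hf'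
    have h1 : (-1:ℝ) ∉ Ioo (-1:ℝ) 1 := by simp
    rw [ContinuousWithinAt, expPos_of_notMem h1]
    have hlim : Tendsto (fun x : ℝ => (x + 1) ^ C) (𝓝[Ico (-1) 1] (-1)) (𝓝 0) := by
      have : ContinuousAt (fun x : ℝ => (x + 1) ^ C) (-1) :=
        ContinuousAt.rpow_const (by fun_prop) (Or.inr hC.le)
      have h2 := this.tendsto.mono_left (nhdsWithin_le_nhds (s := Ico (-1:ℝ) 1))
      simpa [Real.zero_rpow hC.ne'] using h2
    refine squeeze_zero' (Eventually.of_forall (expPos_nonneg f)) ?_ hlim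
    filter_upwards [self_mem_nhdsWithin,
      mem_nhdsWithin_of_mem_nhds (Iio_mem_nhds (by norm_num : (-1:ℝ) < 0))] with y hy hy'
    rcases eq_or_lt_of_le hy.1 with rfl | hlt
    · simp [expPos_of_notMem h1, Real.zero_rpow hC.ne']
    · rw [expPos_of_mem ⟨hlt, hy.2⟩, Real.rpow_def_of_pos (by linarith), Real.exp_le_exp, mul_comm]
      exact hb y ⟨hlt, le_of_lt hy'⟩
  · exact (hf.hasDerivAt_expPos ⟨lt_of_le_of_ne hx.1 h1.symm, hx.2⟩).continuousAt.continuousWithinAt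

theorem continuousOn_greenKernel (hf : IsProfile f) (hf' : ContinuousOn (deriv f) (Icc (-1) 1))
    (y : ℝ) : ContinuousOn (fun x => greenKernel f x y) (Icc (-1) 1) := by
  by_cases hy : y ∈ Ioo (-1:ℝ) 1
  swap
  · simp_rw [greenKernel_of_notMem hy]
    exact continuousOn_const
  intro x hx
  have hP : x ≠ 1 → ContinuousWithinAt (expPos f) (Icc (-1) 1) x := fun h => by
    have hx' : x ∈ Ico (-1:ℝ) 1 := ⟨hx.1, lt_of_le_of_ne hx.2 h⟩
    refine (hf.continuousOn_expPos hf' x hx').mono_of_mem_nhdsWithin ?_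
    filter_upwards [self_mem_nhdsWithin, mem_nhdsWithin_of_mem_nhds (Iio_mem_nhds hx'.2)]
      with z hz hz'
    exact ⟨hz.1, hz'⟩
  have hN : x ≠ -1 → ContinuousWithinAt (expNeg f) (Icc (-1) 1) x := fun h => by
    have hx' : x ∈ Ioc (-1:ℝ) 1 := ⟨lt_of_le_of_ne hx.1 h.symm, hx.2⟩
    refine (hf.continuousOn_expNeg hf' x hx').mono_of_mem_nhdsWithin ?_
    filter_upwards [self_mem_nhdsWithin, mem_nhdsWithin_of_mem_nhds (Ioi_mem_nhds hx'.1)]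
      with z hz hz'
    exact ⟨hz', hz.2⟩
  by_cases h : x ∈ Ioo (-1:ℝ) 1
  · exact ((hP h.2.ne).mul continuousWithinAt_const).min
      (continuousWithinAt_const.mul (hN h.1.ne'))
  · rw [ContinuousWithinAt, greenKernel_symm, greenKernel_of_notMem h]
    rcases eq_or_ne x 1 with h1 | h1
    · have := (hN (by rw [h1]; norm_num)).const_mul (expPos f y)
      rw [ContinuousWithinAt, expNeg_of_notMem h, mul_zero] at this
      exact squeeze_zero (fun z => greenKernel_nonneg f z y) (fun z => min_le_right _ _) this
    · have := (hP h1).mul_const (expNeg f y)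
      rw [ContinuousWithinAt, expPos_of_notMem h, zero_mul] at this
      exact squeeze_zero (fun z => greenKernel_nonneg f z y) (fun z => min_le_left _ _) this

theorem measurable_expPos (hf : IsProfile f) : Measurable (expPos f) := by
  classical
  rw [expPos, ← piecewise_eq_indicator]
  refine ContinuousOn.measurable_piecewise (fun x hx => ?_) continuousOn_const measurableSet_Ioo
  exact (hf.hasDerivAt_isothermal hx).exp.continuousAt.continuousWithinAt

theorem measurable_expNeg (hf : IsProfile f) : Measurable (expNeg f) := by
  classical
  rw [expNeg, ← piecewise_eq_indicator]
  refine ContinuousOn.measurable_piecewise (fun x hx => ?_) continuousOn_const measurableSet_Ioo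
  exact (hf.hasDerivAt_isothermal hx).neg.exp.continuousAt.continuousWithinAt

theorem measurable_greenKernel (hf : IsProfile f) :
    Measurable (Function.uncurry (greenKernel f)) :=
  ((hf.measurable_expPos.comp measurable_fst).mul (hf.measurable_expNeg.comp measurable_snd)).min
    ((hf.measurable_expPos.comp measurable_snd).mul (hf.measurable_expNeg.comp measurable_fst))

/-- The Green's operator of `L_1` has a positive eigenfunction. -/
theorem exists_greenKernel_eigenfunction (hf : IsProfile f)
    (hf' : ContinuousOn (deriv f) (Icc (-1) 1)) :
    ∃ M : ℝ, 0 < M ∧ ∃ u : ℝ → ℝ, ContinuousOn u (Icc (-1) 1) ∧ (∀ x ∈ Ioo (-1:ℝ) 1, 0 < u x) ∧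
      ∀ x ∈ Icc (-1:ℝ) 1, M * u x = ∫ y in (-1:ℝ)..1, greenKernel f x y * u y := by
  let X := Icc (-1:ℝ) 1
  let μ : Measure X := Measure.comap Subtype.val volume
  have huniv : μ univ = 2 := by
    rw [Measure.comap_apply _ Subtype.val_injective
      (fun s hs => measurableSet_Icc.subtype_image hs) _ MeasurableSet.univ, image_univ,
      Subtype.range_coe, Real.volume_Icc]
    norm_num
  have hfin : IsFiniteMeasure μ := ⟨by rw [huniv]; exact ENNReal.ofNat_lt_top⟩
  have hμ : μ ≠ 0 := by
    intro h
    rw [h] at huniv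
    simp at huniv
  have hIoo : ∀ᵐ x : X ∂μ, (x : ℝ) ∈ Ioo (-1:ℝ) 1 := by
    refine (ae_restrict_iff_subtype (p := fun x : ℝ => x ∈ Ioo (-1:ℝ) 1) measurableSet_Icc).1 ?_
    rw [← restrict_Ioo_eq_restrict_Icc]
    exact ae_restrict_mem measurableSet_Ioo
  obtain ⟨M, hM, w, hwc, hwpos, hw⟩ := KernelOperator.exists_nonneg_eigenfunction μ hμ
    (fun x y : X => greenKernel f x y)
    (hf.measurable_greenKernel.comp (by fun_prop : Measurable fun z : X × X => (z.1.1, z.2.1)))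
    1 (fun x y => greenKernel_le_one f x y) (fun x y => greenKernel_nonneg f x y)
    (hIoo.mono fun x hx => hIoo.mono fun y hy => greenKernel_pos hx hy)
    (fun x y => greenKernel_symm f x y)
    (fun y => (hf.continuousOn_greenKernel hf' y).domRestrict)
  have hu : ∀ x : X, IccExtend (by norm_num : (-1:ℝ) ≤ 1) w x = w x := fun x =>
    IccExtend_val _ _ _
  refine ⟨M, hM, IccExtend (by norm_num) w, hwc.Icc_extend'.continuousOn, ?_, ?_⟩
  · intro x hx
    rw [IccExtend_of_mem _ _ (Ioo_subset_Icc_self hx)]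
    exact hwpos _ (hIoo.mono fun y hy => greenKernel_pos hx hy)
  · intro x hx
    rw [IccExtend_of_mem _ _ hx, hw, integral_of_le (by norm_num), ← integral_Icc_eq_integral_Ioc,
      ← integral_subtype_comap measurableSet_Icc]
    simp only [hu]
    rfl

/-- `L_1` has a positive eigenfunction `u`, given by its first-order system with flux `P = f u'`. -/
theorem exists_ground_state (hf : IsProfile f) (hf' : ContinuousOn (deriv f) (Icc (-1) 1)) :
    ∃ lam : ℝ, 0 < lam ∧ ∃ u P : ℝ → ℝ, ContinuousOn u (Icc (-1) 1) ∧ u (-1) = 0 ∧ u 1 = 0 ∧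
      ∀ x ∈ Ioo (-1:ℝ) 1, 0 < u x ∧ |P x| ≤ u x ∧ HasDerivAt u (P x / f x) x ∧
        HasDerivAt P (u x / f x - lam * u x) x := by
  obtain ⟨M, hM, u, hu, hpos, hMu⟩ := hf.exists_greenKernel_eigenfunction hf'
  have hend : ∀ x ∈ Icc (-1:ℝ) 1, x ∉ Ioo (-1:ℝ) 1 → u x = 0 := fun x hx hx' => by
    have h := hMu x hx
    simp only [fun y => greenKernel_symm f x y, greenKernel_of_notMem hx', zero_mul,
      intervalIntegral.integral_zero] at h
    exact (mul_eq_zero.1 h).resolve_left hM.ne'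
  have hunn : ∀ x ∈ Icc (-1:ℝ) 1, 0 ≤ u x := fun x hx => by
    by_cases h : x ∈ Ioo (-1:ℝ) 1
    · exact (hpos x h).le
    · exact (hend x hx h).ge
  have hcE : ContinuousOn (fun y => expPos f y * u y) (Ico (-1) 1) :=
    (hf.continuousOn_expPos hf').mul (hu.mono Ico_subset_Icc_self)
  have hcF : ContinuousOn (fun y => expNeg f y * u y) (Ioc (-1) 1) :=
    (hf.continuousOn_expNeg hf').mul (hu.mono Ioc_subset_Icc_self)
  have hiE : ∀ x ∈ Ioo (-1:ℝ) 1, IntervalIntegrable (fun y => expPos f y * u y) volume (-1) x :=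
    fun x hx => (hcE.mono (by
      rw [uIcc_of_le hx.1.le]
      exact fun y hy => ⟨hy.1, hy.2.trans_lt hx.2⟩)).intervalIntegrable
  have hiF : ∀ x ∈ Ioo (-1:ℝ) 1, IntervalIntegrable (fun y => expNeg f y * u y) volume x 1 :=
    fun x hx => (hcF.mono (by
      rw [uIcc_of_le hx.2.le]
      exact fun y hy => ⟨hx.1.trans_le hy.1, hy.2⟩)).intervalIntegrable
  set A : ℝ → ℝ := fun x => ∫ y in (-1:ℝ)..x, expPos f y * u y with hA
  set B : ℝ → ℝ := fun x => ∫ y in x..1, expNeg f y * u y with hB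
  have hdA : ∀ x ∈ Ioo (-1:ℝ) 1, HasDerivAt A (expPos f x * u x) x := fun x hx =>
    integral_hasDerivAt_right (hiE x hx)
      ((hcE.mono Ioo_subset_Ico_self).stronglyMeasurableAtFilter isOpen_Ioo x hx)
      ((hcE.mono Ioo_subset_Ico_self).continuousAt (isOpen_Ioo.mem_nhds hx))
  have hdB : ∀ x ∈ Ioo (-1:ℝ) 1, HasDerivAt B (-(expNeg f x * u x)) x := fun x hx =>
    integral_hasDerivAt_left (hiF x hx)
      ((hcF.mono Ioo_subset_Ioc_self).stronglyMeasurableAtFilter isOpen_Ioo x hx)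
      ((hcF.mono Ioo_subset_Ioc_self).continuousAt (isOpen_Ioo.mem_nhds hx))
  have hA0 : ∀ x ∈ Ioo (-1:ℝ) 1, 0 ≤ A x := fun x hx =>
    intervalIntegral.integral_nonneg hx.1.le fun y hy =>
      mul_nonneg (expPos_nonneg f y) (hunn y ⟨hy.1, hy.2.trans hx.2.le⟩)
  have hB0 : ∀ x ∈ Ioo (-1:ℝ) 1, 0 ≤ B x := fun x hx =>
    intervalIntegral.integral_nonneg hx.2.le fun y hy =>
      mul_nonneg (expNeg_nonneg f y) (hunn y ⟨hx.1.le.trans hy.1, hy.2⟩)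
  have hsplit : ∀ x ∈ Ioo (-1:ℝ) 1, u x = M⁻¹ * (expNeg f x * A x + expPos f x * B x) := by
    intro x hx
    have h1 : EqOn (fun y => expNeg f x * (expPos f y * u y)) (fun y => greenKernel f x y * u y)
        (uIcc (-1) x) := fun y hy => by
      rw [uIcc_of_le hx.1.le] at hy
      by_cases h : y ∈ Ioo (-1:ℝ) 1
      · simp only [hf.greenKernel_eq_of_le hx h hy.2]
        ring
      · simp [hend y ⟨hy.1, hy.2.trans hx.2.le⟩ h]
    have h2 : EqOn (fun y => expPos f x * (expNeg f y * u y)) (fun y => greenKernel f x y * u y)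
        (uIcc x 1) := fun y hy => by
      rw [uIcc_of_le hx.2.le] at hy
      by_cases h : y ∈ Ioo (-1:ℝ) 1
      · simp only [greenKernel_symm f x y, hf.greenKernel_eq_of_le h hx hy.1]
        ring
      · simp [hend y ⟨hx.1.le.trans hy.1, hy.2⟩ h]
    have h := hMu x (Ioo_subset_Icc_self hx)
    rw [← integral_add_adjacent_intervals (b := x)
        (((hiE x hx).const_mul _).congr (h1.mono uIoc_subset_uIcc))
        (((hiF x hx).const_mul _).congr (h2.mono uIoc_subset_uIcc)),
      ← intervalIntegral.integral_congr h1, ← intervalIntegral.integral_congr h2,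
      intervalIntegral.integral_const_mul, intervalIntegral.integral_const_mul] at h
    rw [← h, inv_mul_cancel_left₀ hM.ne']
  refine ⟨2 / M, by positivity, u, fun x => M⁻¹ * (expPos f x * B x - expNeg f x * A x), hu,
    hend _ (by norm_num) (by norm_num), hend _ (by norm_num) (by norm_num), fun x hx =>
    ⟨hpos x hx, ?_, ?_, ?_⟩⟩
  · have ha := mul_nonneg (expNeg_nonneg f x) (hA0 x hx)
    have hb := mul_nonneg (expPos_nonneg f x) (hB0 x hx)
    rw [hsplit x hx, abs_mul, abs_of_pos (inv_pos.2 hM)]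
    gcongr
    rw [abs_le]
    constructor <;> linarith
  · have h := (((hf.hasDerivAt_expNeg hx).mul (hdA x hx)).add
      ((hf.hasDerivAt_expPos hx).mul (hdB x hx))).const_mul M⁻¹
    refine (h.congr_of_eventuallyEq (by
      filter_upwards [isOpen_Ioo.mem_nhds hx] with y hy using hsplit y hy)).congr_deriv ?_
    ring
  · have h := (((hf.hasDerivAt_expPos hx).mul (hdB x hx)).sub
      ((hf.hasDerivAt_expNeg hx).mul (hdA x hx))).const_mul M⁻¹
    refine h.congr_deriv ?_
    have h1 := expPos_mul_expNeg (f := f) hx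
    have h2 : u x / f x = M⁻¹ * (expNeg f x * A x + expPos f x * B x) / f x := by
      rw [← hsplit x hx]
    rw [h2]
    linear_combination (-2 * M⁻¹ * u x) * h1

end IsProfile

theorem contDiffOn_of_system {f u P : ℝ → ℝ} {s : Set ℝ} (hs : IsOpen s)
    (hf : ContDiffOn ℝ (⊤ : ℕ∞) f s) (hf0 : ∀ x ∈ s, f x ≠ 0) {lam : ℝ}
    (hu : ∀ x ∈ s, HasDerivAt u (P x / f x) x)
    (hP : ∀ x ∈ s, HasDerivAt P (u x / f x - lam * u x) x) :
    ContDiffOn ℝ (⊤ : ℕ∞) u s := by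
  have key : ∀ n : ℕ, ContDiffOn ℝ n u s ∧ ContDiffOn ℝ n P s := by
    intro n
    induction n with
    | zero =>
      simp only [CharP.cast_eq_zero, contDiffOn_zero]
      exact ⟨fun x hx => (hu x hx).continuousAt.continuousWithinAt,
        fun x hx => (hP x hx).continuousAt.continuousWithinAt⟩
    | succ n ih =>
      have hfn : ContDiffOn ℝ n f s := hf.of_le (by exact_mod_cast le_top)
      push_cast
      rw [contDiffOn_succ_iff_deriv_of_isOpen hs, contDiffOn_succ_iff_deriv_of_isOpen hs]
      refine ⟨⟨fun x hx => (hu x hx).differentiableAt.differentiableWithinAt, by simp, ?_⟩,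
        ⟨fun x hx => (hP x hx).differentiableAt.differentiableWithinAt, by simp, ?_⟩⟩
      · exact (ih.2.div hfn hf0).congr fun x hx => (hu x hx).deriv
      · exact ((ih.1.div hfn hf0).sub (contDiffOn_const.mul ih.1)).congr
          fun x hx => (hP x hx).deriv
  exact contDiffOn_infty.2 fun n => (key n).1

theorem inSpec_zero_zero (f : ℝ → ℝ) : InSpec f 0 0 :=
  ⟨fun _ => 1, continuousOn_const, contDiffOn_const, ⟨0, by norm_num, one_ne_zero⟩,
    fun h => absurd h (by norm_num), fun x _ => by simp⟩

theorem inSpec_one_of_system {f u P : ℝ → ℝ} (hf : IsProfile f) {lam : ℝ}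
    (hc : ContinuousOn u (Icc (-1) 1)) (hl : u (-1) = 0) (hr : u 1 = 0)
    (hpos : ∀ x ∈ Ioo (-1:ℝ) 1, 0 < u x)
    (hu : ∀ x ∈ Ioo (-1:ℝ) 1, HasDerivAt u (P x / f x) x)
    (hP : ∀ x ∈ Ioo (-1:ℝ) 1, HasDerivAt P (u x / f x - lam * u x) x) :
    InSpec f 1 lam := by
  refine ⟨u, hc, contDiffOn_of_system isOpen_Ioo hf.smoothOn (fun x hx => (hf.pos x hx).ne') hu hP,
    ⟨0, by norm_num, (hpos 0 (by norm_num)).ne'⟩, fun _ => ⟨hl, hr⟩, fun x hx => ?_⟩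
  have h : (fun y => f y * deriv u y) =ᶠ[𝓝 x] P := by
    filter_upwards [isOpen_Ioo.mem_nhds hx] with y hy
    rw [(hu y hy).deriv, mul_div_cancel₀ _ (hf.pos y hy).ne']
  rw [h.deriv_eq, (hP x hx).deriv]
  push_cast
  ring

theorem IsProfile.hasDerivAt_deriv {f : ℝ → ℝ} (hf : IsProfile f) {x : ℝ}
    (hx : x ∈ Ioo (-1:ℝ) 1) : HasDerivAt (deriv f) (deriv (deriv f) x) x := by
  rw [hasDerivAt_deriv_iff]
  have h : ContDiffOn ℝ (1 + 1) f (Ioo (-1) 1) := hf.smoothOn.of_le (by norm_cast)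
  have h' := ((contDiffOn_succ_iff_deriv_of_isOpen isOpen_Ioo).1 h).2.2
  exact (h'.contDiffAt (isOpen_Ioo.mem_nhds hx)).differentiableAt one_ne_zero

theorem eq_of_hasDerivAt_zero {Q : ℝ → ℝ} (hc : ContinuousOn Q (Icc (-1) 1))
    (hd : ∀ x ∈ Ioo (-1:ℝ) 1, HasDerivAt Q 0 x) {x : ℝ} (hx : x ∈ Icc (-1:ℝ) 1) :
    Q x = Q (-1) := by
  rcases eq_or_lt_of_le hx.1 with rfl | h
  · rfl
  obtain ⟨c, -, hc'⟩ := exists_hasDerivAt_eq_slope Q (fun _ => 0) h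
    (hc.mono (Icc_subset_Icc_right hx.2)) fun y hy => hd y ⟨hy.1, hy.2.trans_le hx.2⟩
  rcases div_eq_zero_iff.1 hc'.symm with h' | h' <;> linarith

/-- The profile functions for which `√f` is an eigenfunction of `L_1` are round. -/
theorem IsProfile.eq_round_of_ode {f : ℝ → ℝ} (hf : IsProfile f)
    (hf' : ContinuousOn (deriv f) (Icc (-1) 1)) {lam : ℝ}
    (hode : ∀ x ∈ Ioo (-1:ℝ) 1,
      4 - deriv f x ^ 2 - 2 * (f x * deriv (deriv f) x) = 4 * (lam * f x)) :
    ∀ x ∈ Icc (-1:ℝ) 1, f x = 1 - x ^ 2 := by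
  have hI : ∀ x ∈ Ioo (-1:ℝ) 1, x ∈ Icc (-1:ℝ) 1 := fun x hx => Ioo_subset_Icc_self hx
  have h1 : ∀ x ∈ Icc (-1:ℝ) 1, f x * deriv f x ^ 2 - 4 * f x + 2 * lam * f x ^ 2 = 0 := by
    intro x hx
    have hc : ContinuousOn (fun x => f x * deriv f x ^ 2 - 4 * f x + 2 * lam * f x ^ 2)
        (Icc (-1) 1) := by
      have := hf.contOn
      fun_prop
    have := eq_of_hasDerivAt_zero hc (fun y hy => by
      have d1 := hf.hasDerivAt (hI y hy)
      have d2 := hf.hasDerivAt_deriv hy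
      refine (((d1.mul (d2.pow 2)).sub (d1.const_mul 4)).add
        ((d1.pow 2).const_mul (2 * lam))).congr_deriv ?_
      simp only [Pi.pow_apply]
      push_cast
      linear_combination (-deriv f y) * hode y hy) hx
    simpa [hf.zero_neg_one] using this
  have h2 : ∀ x ∈ Ioo (-1:ℝ) 1, deriv (deriv f) x = -lam := by
    intro x hx
    have hp := (hf.pos x hx).ne'
    have e1 := h1 x (hI x hx)
    have e2 : deriv f x ^ 2 = 4 - 2 * lam * f x := by
      apply mul_left_cancel₀ hp
      linear_combination e1
    apply mul_left_cancel₀ hp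
    linear_combination (-1/2) * hode x hx - (1/2) * e2
  have h3 : ∀ x ∈ Icc (-1:ℝ) 1, deriv f x + lam * x = 2 - lam := by
    intro x hx
    have := eq_of_hasDerivAt_zero (Q := fun x => deriv f x + lam * x) (by fun_prop) (fun y hy => by
      have d2 := hf.hasDerivAt_deriv hy
      refine (d2.add ((hasDerivAt_id y).const_mul lam)).congr_deriv ?_
      rw [h2 y hy]; ring) hx
    simp only [hf.deriv_neg_one.deriv] at this
    linear_combination this
  have hlam : lam = 2 := by
    have := h3 1 (by norm_num)
    rw [hf.deriv_one.deriv] at this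
    linarith
  intro x hx
  have := eq_of_hasDerivAt_zero (Q := fun x => f x + x ^ 2)
    (hf.contOn.add (by fun_prop)) (fun y hy => by
      refine ((hf.hasDerivAt (hI y hy)).add (hasDerivAt_pow 2 y)).congr_deriv ?_
      have := h3 y (hI y hy)
      rw [hlam] at this
      push_cast
      linear_combination this) hx
  simp only [hf.zero_neg_one] at this
  linarith

/-- Barta–Picone comparison of the bottom eigenvalue of `L_1` with the energy of `√f`: a ground
state `u` of eigenvalue at least the energy has `2 f u' / u = f'`. -/
theorem IsProfile.deriv_eq_of_energy_le {f u P : ℝ → ℝ} (hf : IsProfile f)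
    (hf' : ContinuousOn (deriv f) (Icc (-1) 1)) {lam : ℝ}
    (hpos : ∀ x ∈ Ioo (-1:ℝ) 1, 0 < u x) (hPu : ∀ x ∈ Ioo (-1:ℝ) 1, |P x| ≤ u x)
    (hu : ∀ x ∈ Ioo (-1:ℝ) 1, HasDerivAt u (P x / f x) x)
    (hP : ∀ x ∈ Ioo (-1:ℝ) 1, HasDerivAt P (u x / f x - lam * u x) x)
    (hle : ∫ x in (-1:ℝ)..1, (1 + deriv f x ^ 2 / 4) ≤ lam * ∫ x in (-1:ℝ)..1, f x) :
    ∀ x ∈ Ioo (-1:ℝ) 1, deriv f x = 2 * (P x / u x) := by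
  set p : ℝ → ℝ := fun x => P x / u x with hp
  have hI : ∀ x ∈ Ioo (-1:ℝ) 1, x ∈ Icc (-1:ℝ) 1 := fun x hx => Ioo_subset_Icc_self hx
  have hp1 : ∀ x ∈ Ioo (-1:ℝ) 1, |p x| ≤ 1 := fun x hx => by
    rw [hp]
    simp only [abs_div, abs_of_pos (hpos x hx)]
    exact (div_le_one (hpos x hx)).2 (hPu x hx)
  have hpd : ∀ x ∈ Ioo (-1:ℝ) 1, HasDerivAt p (1 / f x - lam - p x ^ 2 / f x) x := fun x hx => by
    have h0 := (hpos x hx).ne'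
    have h1 := (hf.pos x hx).ne'
    refine ((hP x hx).div (hu x hx) h0).congr_deriv ?_
    simp only [hp]
    field_simp
  have hpc : ContinuousOn p (Ioo (-1) 1) := fun x hx =>
    (hpd x hx).continuousAt.continuousWithinAt
  have hfpd : ∀ x ∈ Ioo (-1:ℝ) 1,
      HasDerivAt (fun x => f x * p x) (deriv f x * p x + 1 - lam * f x - p x ^ 2) x := by
    intro x hx
    have h1 := (hf.pos x hx).ne'
    refine ((hf.hasDerivAt (hI x hx)).mul (hpd x hx)).congr_deriv ?_
    field_simp
    ring
  have hIcc : ∀ x ∈ Icc (-1:ℝ) 1, x ∈ Ioo (-1:ℝ) 1 ∨ f x = 0 := fun x hx => by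
    rcases eq_or_ne x (-1) with rfl | h1
    · exact Or.inr hf.zero_neg_one
    rcases eq_or_ne x 1 with rfl | h2
    · exact Or.inr hf.zero_one
    exact Or.inl ⟨lt_of_le_of_ne hx.1 h1.symm, lt_of_le_of_ne hx.2 h2⟩
  have hfpc : ContinuousOn (fun x => f x * p x) (Icc (-1) 1) := by
    intro a ha
    rcases hIcc a ha with h | hfa
    · exact (hfpd a h).continuousAt.continuousWithinAt
    rw [ContinuousWithinAt, hfa, zero_mul]
    have h1 : Tendsto (fun x => |f x|) (𝓝[Icc (-1) 1] a) (𝓝 0) := by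
      have := (hf.contOn a ha).abs
      simpa [ContinuousWithinAt, hfa] using this
    refine squeeze_zero_norm' ?_ h1
    filter_upwards [self_mem_nhdsWithin] with x hx
    rw [Real.norm_eq_abs, abs_mul]
    rcases hIcc x hx with h | h
    · exact mul_le_of_le_one_right (abs_nonneg _) (hp1 x h)
    · simp [h]
  have hbdd : ∀ g : ℝ → ℝ, ContinuousOn g (Ioo (-1) 1) → (∃ C, ∀ x ∈ Ioo (-1:ℝ) 1, |g x| ≤ C) →
      IntervalIntegrable g volume (-1) 1 := by
    rintro g hg ⟨C, hC⟩
    rw [intervalIntegrable_iff_integrableOn_Ioo_of_le (by norm_num)]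
    exact IntegrableOn.of_bound (by simp) (hg.aestronglyMeasurable measurableSet_Ioo) C
      (ae_restrict_of_forall_mem measurableSet_Ioo hC)
  obtain ⟨C, hC⟩ := (isCompact_Icc.exists_bound_of_continuousOn hf')
  have if' : IntervalIntegrable (fun x => 1 + deriv f x ^ 2 / 4) volume (-1) 1 := by
    refine ContinuousOn.intervalIntegrable ?_
    rw [uIcc_of_le (by norm_num)]
    fun_prop
  have iflam : IntervalIntegrable (fun x => lam * f x) volume (-1) 1 := by
    refine ContinuousOn.intervalIntegrable ?_
    rw [uIcc_of_le (by norm_num)]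
    exact continuousOn_const.mul hf.contOn
  have isq : IntervalIntegrable (fun x => (deriv f x / 2 - p x) ^ 2) volume (-1) 1 := by
    refine hbdd _ (by have := hf'.mono Ioo_subset_Icc_self; fun_prop) ⟨(C / 2 + 1) ^ 2, ?_⟩
    intro x hx
    rw [abs_pow]
    refine pow_le_pow_left₀ (abs_nonneg _) ?_ 2
    have h1 := hC x (hI x hx)
    have h2 := hp1 x hx
    rw [Real.norm_eq_abs] at h1
    rw [abs_le] at *
    constructor <;> linarith [h1.1, h1.2, h2.1, h2.2]
  have hftc := integral_eq_sub_of_hasDerivAt_of_le (a := -1) (b := 1) (by norm_num) hfpc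
    (f' := fun x => (1 + deriv f x ^ 2 / 4) - lam * f x - (deriv f x / 2 - p x) ^ 2)
    (fun x hx => (hfpd x hx).congr_deriv (by ring)) ((if'.sub iflam).sub isq)
  rw [integral_sub (if'.sub iflam) isq, integral_sub if' iflam, intervalIntegral.integral_const_mul,
    hf.zero_one, hf.zero_neg_one] at hftc
  have hnn : 0 ≤ ∫ x in (-1:ℝ)..1, (deriv f x / 2 - p x) ^ 2 :=
    integral_nonneg (by norm_num) fun x _ => sq_nonneg _
  have hz : ∫ x in (-1:ℝ)..1, (deriv f x / 2 - p x) ^ 2 = 0 := by linarith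
  rw [integral_of_le (by norm_num), integral_Ioc_eq_integral_Ioo] at hz
  rw [intervalIntegrable_iff_integrableOn_Ioo_of_le (by norm_num)] at isq
  have hae := (MeasureTheory.integral_eq_zero_iff_of_nonneg (fun x => sq_nonneg _) isq).1 hz
  have heqon := Measure.eqOn_open_of_ae_eq hae isOpen_Ioo
    ((((hf'.mono Ioo_subset_Icc_self).div_const 2).sub hpc).pow 2) continuousOn_const
  intro x hx
  have : (deriv f x / 2 - p x) ^ 2 = 0 := heqon hx
  have := pow_eq_zero_iff (two_ne_zero) |>.1 this
  change _ = 2 * p x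
  linarith

theorem IsProfile.integral_mul_deriv_deriv {f : ℝ → ℝ} (hf : IsProfile f)
    (hf' : ContinuousOn (deriv f) (Icc (-1) 1))
    (hint : IntervalIntegrable (fun x => f x * deriv (deriv f) x) volume (-1) 1) :
    ∫ x in (-1:ℝ)..1, f x * deriv (deriv f) x = - ∫ x in (-1:ℝ)..1, deriv f x ^ 2 := by
  have i2 : IntervalIntegrable (fun x => deriv f x ^ 2) volume (-1) 1 := by
    refine ContinuousOn.intervalIntegrable ?_
    rw [uIcc_of_le (by norm_num)]
    fun_prop
  have hftc := integral_eq_sub_of_hasDerivAt_of_le (a := -1) (b := 1) (by norm_num)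
    (hf.contOn.mul hf') (f' := fun x => deriv f x ^ 2 + f x * deriv (deriv f) x)
    (fun x hx => by
      refine ((hf.hasDerivAt (Ioo_subset_Icc_self hx)).mul
        (hf.hasDerivAt_deriv hx)).congr_deriv ?_
      ring) (i2.add hint)
  rw [integral_add i2 hint, Pi.mul_apply, Pi.mul_apply, hf.zero_one, hf.zero_neg_one] at hftc
  linarith

/-- Rigidity for the sharp eigenvalue bounds: if equality holds in the sharp upper bound
for every `m ≥ 1`, then `f(x) = 1 - x²`, i.e. the surface is the round sphere. -/
theorem equality_in_bounds_round (f : ℝ → ℝ) (hf : IsProfile f)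
    (hf' : ContinuousOn (deriv f) (Icc (-1) 1))
    (hint : ∀ m : ℕ, 1 ≤ m →
      IntervalIntegrable (fun x => f x ^ m * deriv (deriv f) x) volume (-1) 1)
    (Λ : ℕ → ℝ) (hΛmono : StrictMono Λ) (hΛrange : Set.range Λ = Eigs f)
    (heq : ∀ m : ℕ, 1 ≤ m →
      Λ m = (m:ℝ)^2 * ((∫ x in (-1:ℝ)..1, f x ^ (m - 1)) / (∫ x in (-1:ℝ)..1, f x ^ m))
        + ((m:ℝ) * ∫ x in (-1:ℝ)..1, f x ^ m * (-(deriv (deriv f) x) / 2))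
            / (2 * ∫ x in (-1:ℝ)..1, f x ^ m)) :
    ∀ x ∈ Icc (-1:ℝ) 1, f x = 1 - x^2 := by
  obtain ⟨lam, hlam, u, P, huc, hul, hur, h⟩ := hf.exists_ground_state hf'
  have hspec := inSpec_one_of_system hf huc hul hur (fun x hx => (h x hx).1)
    (fun x hx => (h x hx).2.2.1) (fun x hx => (h x hx).2.2.2)
  have h0 : (0:ℝ) ∈ Set.range Λ := by
    rw [hΛrange]
    exact mem_iUnion.2 ⟨0, inSpec_zero_zero f⟩
  have h1 : lam ∈ Set.range Λ := by
    rw [hΛrange]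
    exact mem_iUnion.2 ⟨1, hspec⟩
  obtain ⟨i, hi⟩ := h0
  obtain ⟨j, hj⟩ := h1
  have hij : i < j := hΛmono.lt_iff_lt.1 (by rw [hi, hj]; exact hlam)
  have hle : Λ 1 ≤ lam := hj ▸ hΛmono.monotone (by omega)
  have hfpos : 0 < ∫ x in (-1:ℝ)..1, f x := by
    refine intervalIntegral_pos_of_pos_on (ContinuousOn.intervalIntegrable ?_) hf.pos (by norm_num)
    rw [uIcc_of_le (by norm_num)]
    exact hf.contOn
  have hint1 : IntervalIntegrable (fun x => f x * deriv (deriv f) x) volume (-1) 1 := by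
    simpa using hint 1 le_rfl
  have henergy : ∫ x in (-1:ℝ)..1, (1 + deriv f x ^ 2 / 4) = Λ 1 * ∫ x in (-1:ℝ)..1, f x := by
    have i2 : IntervalIntegrable (fun x => deriv f x ^ 2 / 4) volume (-1) 1 := by
      refine ContinuousOn.intervalIntegrable ?_
      rw [uIcc_of_le (by norm_num)]
      fun_prop
    have e1 := heq 1 le_rfl
    have e2 : ∀ x, f x ^ 1 * (-(deriv (deriv f) x) / 2) = (-1/2) * (f x * deriv (deriv f) x) :=
      fun x => by ring
    simp_rw [e2] at e1
    rw [intervalIntegral.integral_const_mul, hf.integral_mul_deriv_deriv hf' hint1] at e1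
    simp only [Nat.cast_one, one_pow, tsub_self, pow_zero, pow_one, one_mul,
      intervalIntegral.integral_const, smul_eq_mul] at e1
    rw [integral_add intervalIntegrable_const i2, intervalIntegral.integral_div,
      intervalIntegral.integral_const, e1]
    field_simp
    ring
  have hp := hf.deriv_eq_of_energy_le hf' (fun x hx => (h x hx).1) (fun x hx => (h x hx).2.1)
    (fun x hx => (h x hx).2.2.1) (fun x hx => (h x hx).2.2.2)
    (henergy.trans_le (mul_le_mul_of_nonneg_right hle hfpos.le))
  refine hf.eq_round_of_ode hf' (lam := lam) fun x hx => ?_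
  have hd : HasDerivAt (fun y => 2 * (P y / u y))
      (2 * (((u x / f x - lam * u x) * u x - P x * (P x / f x)) / u x ^ 2)) x :=
    ((h x hx).2.2.2.div (h x hx).2.2.1 (h x hx).1.ne').const_mul 2
  have hev : deriv f =ᶠ[𝓝 x] fun y => 2 * (P y / u y) := by
    filter_upwards [isOpen_Ioo.mem_nhds hx] with y hy
    exact hp y hy
  rw [hev.deriv_eq, hd.deriv, hp x hx]
  have := (h x hx).1.ne'
  have := (hf.pos x hx).ne'
  field_simp
  ring
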